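/- Let k_R ∈ G^∞(Ω×Ω) and let R be the integral operator with kernel k_R, extended to the dual by RT(u) := T(ᵗRu) where ᵗRu(y) = ∫_Ω k_R(x,y)u(x)dx. If T ∈ L(G(Ω),ℂ̃) is basic, then RT = (x ↦ T(k_R(x,·))) belongs to G^∞(Ω); i.e. operators with regular generalized kernel are G^∞-regularizing on basic functionals of L(G(Ω),ℂ̃). -/

import Mathlib

noncomputable section

open Set MeasureTheory Topology

/-- Euclidean space `ℝ^n`. -/
abbrev Rn (n : ℕ) := EuclideanSpace ℝ (Fin n)

namespace Colombeau

/-- A net of smooth functions on the open set `Ω ⊆ E` is *moderate*: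
for every compact `K ⊆ Ω` and derivative order `i` there is `N` with
`sup_{x∈K} ‖∂^i u_ε(x)‖ = O(ε^{-N})` as `ε → 0`. -/
def IsModerate {E : Type} [NormedAddCommGroup E] [NormedSpace ℝ E]
    (Ω : Set E) (u : ℝ → E → ℂ) : Prop :=
  (∀ ε ∈ Ioc (0:ℝ) 1, ContDiffOn ℝ (⊤ : ℕ∞) (u ε) Ω) ∧
  ∀ K : Set E, IsCompact K → K ⊆ Ω → ∀ i : ℕ,
    ∃ N : ℕ, ∃ c > 0, ∃ η ∈ Ioc (0:ℝ) 1, ∀ ε ∈ Ioc (0:ℝ) η, ∀ x ∈ K,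
      ‖iteratedFDeriv ℝ i (u ε) x‖ ≤ c * ε ^ (-(N:ℝ))

/-- A net of smooth functions on `Ω` is *negligible*:
for every compact `K ⊆ Ω`, derivative order `i` and every `q`,
`sup_{x∈K} ‖∂^i u_ε(x)‖ = O(ε^q)` as `ε → 0`. -/
def IsNegligible {E : Type} [NormedAddCommGroup E] [NormedSpace ℝ E]
    (Ω : Set E) (u : ℝ → E → ℂ) : Prop :=
  (∀ ε ∈ Ioc (0:ℝ) 1, ContDiffOn ℝ (⊤ : ℕ∞) (u ε) Ω) ∧
  ∀ K : Set E, IsCompact K → K ⊆ Ω → ∀ i : ℕ, ∀ q : ℕ,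
    ∃ c > 0, ∃ η ∈ Ioc (0:ℝ) 1, ∀ ε ∈ Ioc (0:ℝ) η, ∀ x ∈ K,
      ‖iteratedFDeriv ℝ i (u ε) x‖ ≤ c * ε ^ (q:ℝ)

/-- `G^∞`-moderateness: on each compact set the exponent `N` is uniform in the
derivative order. -/
def IsGinfModerate {E : Type} [NormedAddCommGroup E] [NormedSpace ℝ E]
    (Ω : Set E) (u : ℝ → E → ℂ) : Prop :=
  (∀ ε ∈ Ioc (0:ℝ) 1, ContDiffOn ℝ (⊤ : ℕ∞) (u ε) Ω) ∧
  ∀ K : Set E, IsCompact K → K ⊆ Ω → ∃ N : ℕ, ∀ i : ℕ,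
    ∃ c > 0, ∃ η ∈ Ioc (0:ℝ) 1, ∀ ε ∈ Ioc (0:ℝ) η, ∀ x ∈ K,
      ‖iteratedFDeriv ℝ i (u ε) x‖ ≤ c * ε ^ (-(N:ℝ))

/-- The net `u` has all its supports contained in one fixed compact subset of `Ω`. -/
def HasCmpSupp {E : Type} [NormedAddCommGroup E] [NormedSpace ℝ E]
    (Ω : Set E) (u : ℝ → E → ℂ) : Prop :=
  ∃ K : Set E, IsCompact K ∧ K ⊆ Ω ∧ ∀ ε ∈ Ioc (0:ℝ) 1, tsupport (u ε) ⊆ K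

/-- Moderate nets of complex numbers (representatives of elements of `ℂ̃`). -/
def CIsModerate (z : ℝ → ℂ) : Prop :=
  ∃ N : ℕ, ∃ c > 0, ∃ η ∈ Ioc (0:ℝ) 1, ∀ ε ∈ Ioc (0:ℝ) η, ‖z ε‖ ≤ c * ε ^ (-(N:ℝ))

/-- Negligible nets of complex numbers. -/
def CIsNegligible (z : ℝ → ℂ) : Prop :=
  ∀ q : ℕ, ∃ c > 0, ∃ η ∈ Ioc (0:ℝ) 1, ∀ ε ∈ Ioc (0:ℝ) η, ‖z ε‖ ≤ c * ε ^ (q:ℝ)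

/-- `S` is a distribution on `Ω`: for each compact `K ⊆ Ω` it is continuous with respect
to some seminorm `sup_{x∈K, |α|≤j} |∂^α f(x)|` on smooth functions supported in `K`. -/
def IsDistributionOn {n : ℕ} (Ω : Set (Rn n)) (S : (Rn n → ℂ) →ₗ[ℂ] ℂ) : Prop :=
  ∀ K : Set (Rn n), IsCompact K → K ⊆ Ω →
    ∃ j : ℕ, ∃ C : ℝ, 0 ≤ C ∧ ∀ f : Rn n → ℂ, ContDiffOn ℝ (⊤ : ℕ∞) f Ω → tsupport f ⊆ K →
      ∀ B : ℝ, (∀ x ∈ K, ∀ i ≤ j, ‖iteratedFDeriv ℝ i f x‖ ≤ B) → ‖S f‖ ≤ C * B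

/-- `S` is a compactly supported distribution on `Ω`. -/
def IsCptSuppDistributionOn {n : ℕ} (Ω : Set (Rn n)) (S : (Rn n → ℂ) →ₗ[ℂ] ℂ) : Prop :=
  ∃ K : Set (Rn n), IsCompact K ∧ K ⊆ Ω ∧
    ∃ j : ℕ, ∃ C : ℝ, 0 ≤ C ∧ ∀ f : Rn n → ℂ, ContDiffOn ℝ (⊤ : ℕ∞) f Ω →
      ∀ B : ℝ, (∀ x ∈ K, ∀ i ≤ j, ‖iteratedFDeriv ℝ i f x‖ ≤ B) → ‖S f‖ ≤ C * B

/-- A net of distributions on `Ω` defining a *basic* functional on `G_c(Ω)`: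
for every compact `K ⊆ Ω` there are `j`, `N`, `η ∈ (0,1]` with
`|T_ε(f)| ≤ ε^{-N} sup_{x∈K,|α|≤j} |∂^α f(x)|` for all smooth `f` supported in `K`
and all `ε ≤ η`. -/
def IsBasicNetC {n : ℕ} (Ω : Set (Rn n)) (T : ℝ → (Rn n → ℂ) →ₗ[ℂ] ℂ) : Prop :=
  (∀ ε ∈ Ioc (0:ℝ) 1, IsDistributionOn Ω (T ε)) ∧
  ∀ K : Set (Rn n), IsCompact K → K ⊆ Ω →
    ∃ j N : ℕ, ∃ η ∈ Ioc (0:ℝ) 1, ∀ ε ∈ Ioc (0:ℝ) η,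
      ∀ f : Rn n → ℂ, ContDiffOn ℝ (⊤ : ℕ∞) f Ω → tsupport f ⊆ K →
        ∀ C : ℝ, 0 ≤ C → (∀ x ∈ K, ∀ i ≤ j, ‖iteratedFDeriv ℝ i f x‖ ≤ C) →
          ‖T ε f‖ ≤ ε ^ (-(N:ℝ)) * C

/-- A net of compactly supported distributions on `Ω` defining a *basic* functional on
`G(Ω)`: there are a compact `K ⊆ Ω` and `j`, `N`, `η ∈ (0,1]` with
`|T_ε(f)| ≤ ε^{-N} sup_{x∈K,|α|≤j} |∂^α f(x)|` for all `f ∈ C^∞(Ω)` and all `ε ≤ η`. -/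
def IsBasicNetE {n : ℕ} (Ω : Set (Rn n)) (T : ℝ → (Rn n → ℂ) →ₗ[ℂ] ℂ) : Prop :=
  (∀ ε ∈ Ioc (0:ℝ) 1, IsCptSuppDistributionOn Ω (T ε)) ∧
  ∃ K : Set (Rn n), IsCompact K ∧ K ⊆ Ω ∧
    ∃ j N : ℕ, ∃ η ∈ Ioc (0:ℝ) 1, ∀ ε ∈ Ioc (0:ℝ) η,
      ∀ f : Rn n → ℂ, ContDiffOn ℝ (⊤ : ℕ∞) f Ω →
        ∀ C : ℝ, 0 ≤ C → (∀ x ∈ K, ∀ i ≤ j, ‖iteratedFDeriv ℝ i f x‖ ≤ C) →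
          ‖T ε f‖ ≤ ε ^ (-(N:ℝ)) * C

end Colombeau

open Colombeau

set_option linter.unusedSectionVars false

section Slices

variable {E E' F : Type} [NormedAddCommGroup E] [NormedSpace ℝ E]
  [NormedAddCommGroup E'] [NormedSpace ℝ E'] [NormedAddCommGroup F] [NormedSpace ℝ F]

/-- Continuous functions on `K` with values in a normed space, the topology of the codomain being
the norm topology. -/
abbrev NormC (K : Set E') (F : Type) [NormedAddCommGroup F] : Type := C(K, F)

open Classical in
/-- The restriction of `φ` to `K` as a continuous map, or `0` if it is not continuous. -/
def restrictC (K : Set E') (φ : E' → F) : NormC K F :=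
  if h : Continuous (fun y : K => φ y) then ⟨fun y : K => φ y, h⟩ else 0

theorem restrictC_apply {K : Set E'} {φ : E' → F} (h : ContinuousOn φ K) (y : K) :
    restrictC K φ y = φ y := by
  have h' : Continuous (fun y : K => φ y) := continuousOn_iff_continuous_domRestrict.1 h
  simp [restrictC, h']

/-- The partial map `x ↦ g (x, ·)` with values in the continuous functions on `K`. -/
def sliceC (K : Set E') (g : E × E' → F) (x : E) : NormC K F :=
  restrictC K (fun y => g (x, y))

theorem continuousOn_slice {K : Set E'} {U : Set E} {V : Set E'} (hKV : K ⊆ V)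
    {g : E × E' → F} (hg : ContinuousOn g (U ×ˢ V)) {x : E} (hx : x ∈ U) :
    ContinuousOn (fun y => g (x, y)) K :=
  hg.comp (by fun_prop) fun _ hy => ⟨hx, hKV hy⟩

theorem sliceC_apply {K : Set E'} {U : Set E} {V : Set E'} (hKV : K ⊆ V)
    {g : E × E' → F} (hg : ContinuousOn g (U ×ˢ V)) {x : E} (hx : x ∈ U) (y : K) :
    sliceC K g x y = g (x, y) :=
  restrictC_apply (continuousOn_slice hKV hg hx) y

theorem continuousOn_sliceC {K : Set E'} [CompactSpace K] {U : Set E} {V : Set E'} (hKV : K ⊆ V)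
    {g : E × E' → F} (hg : ContinuousOn g (U ×ˢ V)) : ContinuousOn (sliceC K g) U := by
  rw [continuousOn_iff_continuous_domRestrict]
  have hc : Continuous (fun p : U × K => g (p.1, p.2)) :=
    hg.comp_continuous (by fun_prop) fun p => ⟨p.1.2, hKV p.2.2⟩
  convert (ContinuousMap.curry ⟨_, hc⟩).continuous using 1
  ext x y
  simp [sliceC_apply hKV hg x.2]

/-- Evaluating an operator-valued continuous function on vectors. -/
def applyC (K : Set E') [CompactSpace K] : NormC K (E →L[ℝ] F) →L[ℝ] E →L[ℝ] NormC K F :=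
  LinearMap.mkContinuous₂
    (LinearMap.mk₂ ℝ (fun (φ : NormC K (E →L[ℝ] F)) (v : E) =>
        (⟨fun y => φ y v, φ.continuous.clm_apply continuous_const⟩ : NormC K F))
      (fun _ _ _ => by ext; simp) (fun _ _ _ => by ext; simp)
      (fun _ _ _ => by ext; simp) (fun _ _ _ => by ext; simp)) 1
    (fun φ v => by
      refine (ContinuousMap.norm_le _ (by positivity)).2 fun y => ?_
      simp only [LinearMap.mk₂_apply, ContinuousMap.coe_mk, one_mul]
      exact (φ y).le_of_opNorm_le (φ.norm_coe_le_norm y) v)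

theorem applyC_apply (K : Set E') [CompactSpace K] (φ : NormC K (E →L[ℝ] F)) (v : E) (y : K) :
    applyC K φ v y = φ y v := rfl

theorem norm_applyC_le (K : Set E') [CompactSpace K] :
    ‖(applyC K : NormC K (E →L[ℝ] F) →L[ℝ] E →L[ℝ] NormC K F)‖ ≤ 1 :=
  LinearMap.mkContinuous₂_norm_le _ zero_le_one _

/-- The partial derivative of `g` in the first variable. -/
def fderivFst (g : E × E' → F) (p : E × E') : E →L[ℝ] F :=
  (fderiv ℝ g p).comp (ContinuousLinearMap.inl ℝ E E')

theorem fderivFst_eq_comp (g : E × E' → F) :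
    fderivFst g = (ContinuousLinearMap.compL ℝ E (E × E') F).flip
      (ContinuousLinearMap.inl ℝ E E') ∘ fderiv ℝ g :=
  rfl

theorem contDiffOn_fderivFst {U : Set (E × E')} (hU : IsOpen U) {g : E × E' → F}
    (hg : ContDiffOn ℝ (⊤ : ℕ∞) g U) : ContDiffOn ℝ (⊤ : ℕ∞) (fderivFst g) U := by
  rw [fderivFst_eq_comp]
  exact (ContinuousLinearMap.contDiff _).comp_contDiffOn (hg.fderiv_of_isOpen hU le_rfl)

theorem hasFDerivAt_sliceC {K : Set E'} [CompactSpace K] {U : Set E} {V : Set E'}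
    (hU : IsOpen U) (hV : IsOpen V) (hKV : K ⊆ V) {g : E × E' → F}
    (hg : ContDiffOn ℝ (⊤ : ℕ∞) g (U ×ˢ V)) {x : E} (hx : x ∈ U) :
    HasFDerivAt (sliceC K g) (applyC K (sliceC K (fderivFst g) x)) x := by
  have hg' := (contDiffOn_fderivFst (hU.prod hV) hg).continuousOn
  have hd : ∀ z ∈ U, ∀ y ∈ K, HasFDerivAt (fun z => g (z, y)) (fderivFst g (z, y)) z := by
    intro z hz y hy
    have h1 : HasFDerivAt g (fderiv ℝ g (z, y)) (z, y) :=
      ((hg.contDiffAt ((hU.prod hV).mem_nhds ⟨hz, hKV hy⟩)).differentiableAt (by simp)).hasFDerivAt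
    exact h1.comp z (hasFDerivAt_prodMk_left z y)
  refine HasFDerivAt.of_isLittleO (Asymptotics.isLittleO_iff.2 fun c hc => ?_)
  have hcont : ContinuousAt (sliceC K (fderivFst g)) x :=
    (continuousOn_sliceC hKV hg').continuousAt (hU.mem_nhds hx)
  obtain ⟨δ, hδ, hball⟩ := Metric.eventually_nhds_iff_ball.1
    ((hU.eventually_mem hx).and (Metric.continuousAt_iff'.1 hcont c hc))
  filter_upwards [Metric.ball_mem_nhds x hδ] with z hz
  refine (ContinuousMap.norm_le _ (by positivity)).2 fun y => ?_
  have hzU := (hball z hz).1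
  simp only [ContinuousMap.sub_apply, applyC_apply, sliceC_apply hKV hg.continuousOn hzU,
    sliceC_apply hKV hg.continuousOn hx, sliceC_apply hKV hg' hx]
  refine (convex_ball x δ).norm_image_sub_le_of_norm_hasFDerivWithin_le'
    (f := fun z => g (z, y)) (f' := fun z => fderivFst g (z, y))
    (fun w hw => (hd w (hball w hw).1 y y.2).hasFDerivWithinAt) (fun w hw => ?_)
    (Metric.mem_ball_self hδ) hz
  have h2 := (hball w hw).2.le
  rw [dist_eq_norm] at h2
  have h3 := ((sliceC K (fderivFst g) w - sliceC K (fderivFst g) x).norm_coe_le_norm y).trans h2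
  simpa only [ContinuousMap.sub_apply, sliceC_apply hKV hg' (hball w hw).1,
    sliceC_apply hKV hg' hx] using h3

theorem contDiffOn_sliceC {K : Set E'} [CompactSpace K] {U : Set E} {V : Set E'}
    (hU : IsOpen U) (hV : IsOpen V) (hKV : K ⊆ V) {g : E × E' → F}
    (hg : ContDiffOn ℝ (⊤ : ℕ∞) g (U ×ˢ V)) : ContDiffOn ℝ (⊤ : ℕ∞) (sliceC K g) U := by
  refine contDiffOn_infty.2 fun m => ?_
  induction m generalizing F with
  | zero => exact contDiffOn_zero.2 (continuousOn_sliceC hKV hg.continuousOn)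
  | succ m ih =>
    push_cast
    refine (contDiffOn_succ_iff_fderiv_of_isOpen hU).2 ⟨fun x hx =>
      (hasFDerivAt_sliceC hU hV hKV hg hx).differentiableAt.differentiableWithinAt,
      by simp, ?_⟩
    exact ((applyC K : NormC K (E →L[ℝ] F) →L[ℝ] E →L[ℝ] NormC K F).contDiff.comp_contDiffOn
      (ih (contDiffOn_fderivFst (hU.prod hV) hg))).congr
      fun x hx => (hasFDerivAt_sliceC hU hV hKV hg hx).fderiv

theorem norm_iteratedFDeriv_sliceC_le {K : Set E'} [CompactSpace K] {U : Set E} {V : Set E'}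
    (hU : IsOpen U) (hV : IsOpen V) (hKV : K ⊆ V) {g : E × E' → F}
    (hg : ContDiffOn ℝ (⊤ : ℕ∞) g (U ×ˢ V)) {x : E} (hx : x ∈ U) (m : ℕ) {B : ℝ} (hB : 0 ≤ B)
    (h : ∀ y ∈ K, ‖iteratedFDeriv ℝ m g (x, y)‖ ≤ B) :
    ‖iteratedFDeriv ℝ m (sliceC K g) x‖ ≤ B := by
  induction m generalizing F with
  | zero =>
    rw [norm_iteratedFDeriv_zero]
    refine (ContinuousMap.norm_le _ hB).2 fun y => ?_
    rw [sliceC_apply hKV hg.continuousOn hx]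
    simpa using h y y.2
  | succ m ih =>
    have hg' := contDiffOn_fderivFst (hU.prod hV) hg
    have he : fderiv ℝ (sliceC K g) =ᶠ[𝓝 x] applyC K ∘ sliceC K (fderivFst g) := by
      filter_upwards [hU.mem_nhds hx] with z hz
      exact (hasFDerivAt_sliceC hU hV hKV hg hz).fderiv
    rw [← norm_iteratedFDeriv_fderiv, (he.iteratedFDeriv ℝ m).eq_of_nhds]
    have h1 := ContinuousLinearMap.norm_iteratedFDeriv_comp_left (F := NormC K (E →L[ℝ] F))
      (G := E →L[ℝ] NormC K F) (applyC K) (n := m)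
      ((contDiffOn_sliceC hU hV hKV hg').contDiffAt (hU.mem_nhds hx)) (by exact_mod_cast le_top)
    refine h1.trans ?_
    refine (mul_le_of_le_one_left (norm_nonneg _) (norm_applyC_le K)).trans
      (ih hg' fun y hy => ?_)
    rw [fderivFst_eq_comp]
    refine (ContinuousLinearMap.norm_iteratedFDeriv_comp_left _
      ((hg.fderiv_of_isOpen (hU.prod hV) (m := (⊤ : ℕ∞)) le_rfl).contDiffAt
        ((hU.prod hV).mem_nhds ⟨hx, hKV hy⟩)) (by exact_mod_cast le_top)).trans ?_
    rw [norm_iteratedFDeriv_fderiv]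
    refine (mul_le_of_le_one_left (norm_nonneg _) ?_).trans (h y hy)
    refine ContinuousLinearMap.opNorm_le_bound _ zero_le_one fun (φ : E × E' →L[ℝ] F) => ?_
    rw [one_mul]
    exact (φ.opNorm_comp_le _).trans
      (mul_le_of_le_one_right (norm_nonneg _) (ContinuousLinearMap.norm_inl_le_one ℝ E E'))

theorem norm_iteratedFDeriv_iteratedFDeriv (f : E → F) (x : E) (m i : ℕ) :
    ‖iteratedFDeriv ℝ m (iteratedFDeriv ℝ i f) x‖ = ‖iteratedFDeriv ℝ (m + i) f x‖ := by
  induction i generalizing m with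
  | zero =>
    rw [iteratedFDeriv_zero_eq_comp]
    exact LinearIsometryEquiv.norm_iteratedFDeriv_comp_left _ _ _ _
  | succ i ih =>
    have h1 := LinearIsometryEquiv.norm_iteratedFDeriv_comp_left (𝕜 := ℝ)
      (continuousMultilinearCurryLeftEquiv ℝ (fun _ : Fin (i + 1) => E) F).symm
      (fderiv ℝ (iteratedFDeriv ℝ i f)) x m
    rw [← iteratedFDeriv_succ_eq_comp_left, norm_iteratedFDeriv_fderiv, ih] at h1
    rw [h1]
    rw [Nat.add_right_comm, add_assoc]

theorem contDiffOn_iteratedFDeriv {U : Set E} (hU : IsOpen U) {f : E → F}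
    (hf : ContDiffOn ℝ (⊤ : ℕ∞) f U) (i : ℕ) :
    ContDiffOn ℝ (⊤ : ℕ∞) (iteratedFDeriv ℝ i f) U := fun x hx =>
  ((hf.contDiffAt (hU.mem_nhds hx)).iteratedFDeriv_right (i := i) (m := (⊤ : ℕ∞))
    (by exact_mod_cast le_top)).contDiffWithinAt

/-- The `i`-th derivative of `g` in the second variable. -/
def iteratedFDerivSnd (i : ℕ) (g : E × E' → F) (p : E × E') : E' [×i]→L[ℝ] F :=
  ContinuousMultilinearMap.compContinuousLinearMapL
    (fun _ : Fin i => ContinuousLinearMap.inr ℝ E E') (iteratedFDeriv ℝ i g p)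

theorem contDiffOn_iteratedFDerivSnd {U : Set (E × E')} (hU : IsOpen U) {g : E × E' → F}
    (hg : ContDiffOn ℝ (⊤ : ℕ∞) g U) (i : ℕ) :
    ContDiffOn ℝ (⊤ : ℕ∞) (iteratedFDerivSnd i g) U :=
  (ContinuousLinearMap.contDiff _).comp_contDiffOn (contDiffOn_iteratedFDeriv hU hg i)

theorem exists_norm_iteratedFDeriv_iteratedFDerivSnd_le (i : ℕ) :
    ∃ b : ℝ, 0 ≤ b ∧ ∀ (U : Set (E × E')), IsOpen U → ∀ g : E × E' → F,
      ContDiffOn ℝ (⊤ : ℕ∞) g U → ∀ p ∈ U, ∀ m : ℕ,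
        ‖iteratedFDeriv ℝ m (iteratedFDerivSnd i g) p‖ ≤ b * ‖iteratedFDeriv ℝ (m + i) g p‖ := by
  refine ⟨‖(ContinuousMultilinearMap.compContinuousLinearMapL
    (fun _ : Fin i => ContinuousLinearMap.inr ℝ E E') :
      ((E × E') [×i]→L[ℝ] F) →L[ℝ] (E' [×i]→L[ℝ] F))‖,
    ContinuousLinearMap.opNorm_nonneg _, fun U hU g hg p hp m => ?_⟩
  rw [← norm_iteratedFDeriv_iteratedFDeriv]
  exact ContinuousLinearMap.norm_iteratedFDeriv_comp_left _
    ((contDiffOn_iteratedFDeriv hU hg i).contDiffAt (hU.mem_nhds hp)) (by exact_mod_cast le_top)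

theorem iteratedFDeriv_slice {U : Set E} {V : Set E'} (hU : IsOpen U) (hV : IsOpen V)
    {g : E × E' → F} (hg : ContDiffOn ℝ (⊤ : ℕ∞) g (U ×ˢ V)) {x : E} (hx : x ∈ U) {y : E'}
    (hy : y ∈ V) (i : ℕ) :
    iteratedFDeriv ℝ i (fun y => g (x, y)) y = iteratedFDerivSnd i g (x, y) := by
  set W : Set (E × E') := (fun p => p + (x, (0 : E'))) ⁻¹' (U ×ˢ V)
  have hW : IsOpen W := (hU.prod hV).preimage (by fun_prop)
  have hgW : ContDiffOn ℝ (⊤ : ℕ∞) (fun p => g (p + (x, (0 : E')))) W :=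
    hg.comp (by fun_prop) fun _ hp => hp
  have hyW : ContinuousLinearMap.inr ℝ E E' y ∈ W := by simp [W, hx, hy]
  have hW' : IsOpen (ContinuousLinearMap.inr ℝ E E' ⁻¹' W) :=
    hW.preimage (ContinuousLinearMap.continuous _)
  have h := (ContinuousLinearMap.inr ℝ E E').iteratedFDerivWithin_comp_right hgW
    hW.uniqueDiffOn hW'.uniqueDiffOn hyW (i := i) (by exact_mod_cast le_top)
  rw [iteratedFDerivWithin_of_isOpen i hW' hyW, iteratedFDerivWithin_of_isOpen i hW hyW,
    iteratedFDeriv_comp_add_right] at h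
  have e : (fun p => g (p + (x, (0 : E')))) ∘ ContinuousLinearMap.inr ℝ E E' =
      fun y => g (x, y) := by
    ext; simp
  rw [e] at h
  rw [h]
  simp [iteratedFDerivSnd]

end Slices
section JetRepresentation

variable {E : Type} [NormedAddCommGroup E] [NormedSpace ℝ E]

/-- The `i`-th derivative of `f` as a continuous function on `K`. -/
def jetC (K : Set E) (i : ℕ) (f : E → ℂ) : NormC K (E [×i]→L[ℝ] ℂ) :=
  restrictC K (iteratedFDeriv ℝ i f)

theorem jetC_apply {K Ω : Set E} (hΩ : IsOpen Ω) (hK : K ⊆ Ω) {f : E → ℂ}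
    (hf : ContDiffOn ℝ (⊤ : ℕ∞) f Ω) (i : ℕ) (y : K) :
    jetC K i f y = iteratedFDeriv ℝ i f y :=
  restrictC_apply ((contDiffOn_iteratedFDeriv hΩ hf i).continuousOn.mono hK) y

/-- The complex vector space of functions that are smooth on `Ω`. -/
def smoothOn (Ω : Set E) : Submodule ℂ (E → ℂ) where
  carrier := {f | ContDiffOn ℝ (⊤ : ℕ∞) f Ω}
  add_mem' := ContDiffOn.add
  zero_mem' := contDiffOn_const
  smul_mem' c _ hf := ContDiffOn.const_smul c hf

/-- The map sending a function to its jet of order `j` on `K`. -/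
def jetMap {K Ω : Set E} (hΩ : IsOpen Ω) (hK : K ⊆ Ω) (j : ℕ) :
    smoothOn Ω →ₗ[ℂ] ((i : Fin (j + 1)) → NormC K (E [×(i : ℕ)]→L[ℝ] ℂ)) where
  toFun f i := jetC K i f
  map_add' f g := by
    ext1 i
    refine ContinuousMap.ext fun y => ?_
    have hf := f.2.contDiffAt (hΩ.mem_nhds (hK y.2))
    have hg := g.2.contDiffAt (hΩ.mem_nhds (hK y.2))
    refine (jetC_apply hΩ hK (f + g).2 i y).trans ?_
    refine (iteratedFDeriv_add_apply (hf.of_le (by exact_mod_cast le_top))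
      (hg.of_le (by exact_mod_cast le_top))).trans ?_
    rw [← jetC_apply hΩ hK f.2, ← jetC_apply hΩ hK g.2]
    rfl
  map_smul' c f := by
    ext1 i
    refine ContinuousMap.ext fun y => ?_
    have hf := f.2.contDiffAt (hΩ.mem_nhds (hK y.2))
    refine (jetC_apply hΩ hK (c • f).2 i y).trans ?_
    refine (iteratedFDeriv_const_smul_apply (hf.of_le (by exact_mod_cast le_top))).trans ?_
    rw [← jetC_apply hΩ hK f.2]
    rfl

/-- Hahn-Banach: a linear functional dominated by the norm of `J` factors through `J`. -/
theorem exists_dual_factorization {V W : Type*} [AddCommGroup V] [Module ℂ V]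
    [NormedAddCommGroup W] [NormedSpace ℂ W] (J : V →ₗ[ℂ] W) (S : V →ₗ[ℂ] ℂ) {C : ℝ} (hC : 0 ≤ C)
    (h : ∀ f, ‖S f‖ ≤ C * ‖J f‖) : ∃ ψ : StrongDual ℂ W, ‖ψ‖ ≤ C ∧ ∀ f, S f = ψ (J f) := by
  obtain ⟨s, hs⟩ := J.rangeRestrict.exists_rightInverse_of_surjective J.range_rangeRestrict
  have hs' : ∀ z : LinearMap.range J, J (s z) = z := fun z =>
    congrArg Subtype.val (LinearMap.congr_fun hs z)
  let φ : StrongDual ℂ (LinearMap.range J) :=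
    (S ∘ₗ s).mkContinuous C fun z => by
      have := h (s z)
      rwa [hs'] at this
  have hφ : ‖φ‖ ≤ C := LinearMap.mkContinuous_norm_le _ hC _
  obtain ⟨ψ, hψ, hψn⟩ := exists_extension_norm_eq (LinearMap.range J) φ
  refine ⟨ψ, hψn.trans_le hφ, fun f => ?_⟩
  have h2 := hψ ⟨J f, LinearMap.mem_range_self J _⟩
  refine Eq.trans ?_ h2.symm
  set z : LinearMap.range J := ⟨J f, LinearMap.mem_range_self J _⟩ with hz
  have h3 := h (f - s z)
  rw [map_sub, map_sub, hs', hz, sub_self, norm_zero, mul_zero, norm_le_zero_iff,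
    sub_eq_zero] at h3
  exact h3

theorem exists_dual_factorization_pi {ι V : Type*} [Fintype ι] {W : ι → Type*} [AddCommGroup V]
    [Module ℂ V] [∀ i, NormedAddCommGroup (W i)] [∀ i, NormedSpace ℂ (W i)]
    (J : V →ₗ[ℂ] ∀ i, W i) (S : V →ₗ[ℂ] ℂ) {C : ℝ} (hC : 0 ≤ C) (h : ∀ f, ‖S f‖ ≤ C * ‖J f‖) :
    ∃ L : ∀ i, StrongDual ℂ (W i), (∀ i w, ‖L i w‖ ≤ C * ‖w‖) ∧ ∀ f, S f = ∑ i, L i (J f i) := by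
  classical
  obtain ⟨ψ, hψn, hψ⟩ := exists_dual_factorization J S hC h
  refine ⟨fun i => ψ.comp (ContinuousLinearMap.single ℂ W i), fun i w => ?_, fun f => ?_⟩
  · exact (ψ.le_opNorm _).trans
      (mul_le_mul hψn (Pi.norm_single _).le (norm_nonneg _) hC)
  · rw [hψ]
    conv_lhs => rw [← Finset.univ_sum_single (J f), map_sum]
    rfl

/-- A linear functional bounded by a `C^j` seminorm on `K` is a sum of continuous functionals
of the derivatives restricted to `K`. -/
theorem exists_jet_representation {K Ω : Set E} [CompactSpace K] (hΩ : IsOpen Ω) (hK : K ⊆ Ω)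
    (S : (E → ℂ) →ₗ[ℂ] ℂ) (j : ℕ) {C : ℝ} (hC : 0 ≤ C)
    (hS : ∀ f : E → ℂ, ContDiffOn ℝ (⊤ : ℕ∞) f Ω → ∀ B : ℝ, 0 ≤ B →
      (∀ x ∈ K, ∀ i ≤ j, ‖iteratedFDeriv ℝ i f x‖ ≤ B) → ‖S f‖ ≤ C * B) :
    ∃ L : (i : Fin (j + 1)) → NormC K (E [×(i : ℕ)]→L[ℝ] ℂ) →L[ℂ] ℂ,
      (∀ i φ, ‖L i φ‖ ≤ C * ‖φ‖) ∧
      ∀ f : E → ℂ, ContDiffOn ℝ (⊤ : ℕ∞) f Ω → S f = ∑ i, L i (jetC K i f) := by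
  set J := jetMap hΩ hK j
  have hSJ : ∀ f : smoothOn Ω, ‖S f‖ ≤ C * ‖J f‖ := by
    refine fun f => hS f f.2 _ (norm_nonneg _) fun x hx i hi => ?_
    have h1 := (norm_le_pi_norm (J f) ⟨i, by omega⟩)
    refine le_trans ?_ ((ContinuousMap.norm_coe_le_norm _ (⟨x, hx⟩ : K)).trans h1)
    exact (congrArg norm (jetC_apply hΩ hK f.2 i ⟨x, hx⟩)).ge
  obtain ⟨L, hL, hSL⟩ := exists_dual_factorization_pi J (S ∘ₗ (smoothOn Ω).subtype) hC hSJ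
  exact ⟨L, hL, fun f hf => hSL ⟨f, hf⟩⟩

end JetRepresentation

section KernelSlices

variable {E : Type} [NormedAddCommGroup E] [NormedSpace ℝ E]

theorem contDiffOn_slice {U V : Set E} {g : E × E → ℂ}
    (hg : ContDiffOn ℝ (⊤ : ℕ∞) g (U ×ˢ V)) {x : E} (hx : x ∈ U) :
    ContDiffOn ℝ (⊤ : ℕ∞) (fun y => g (x, y)) V :=
  hg.comp (by fun_prop) fun _ hy => ⟨hx, hy⟩

theorem jetC_slice {K U V : Set E} (hU : IsOpen U) (hV : IsOpen V) (hK : K ⊆ V) {g : E × E → ℂ}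
    (hg : ContDiffOn ℝ (⊤ : ℕ∞) g (U ×ˢ V)) {x : E} (hx : x ∈ U) (i : ℕ) :
    jetC K i (fun y => g (x, y)) = sliceC K (iteratedFDerivSnd i g) x := by
  refine ContinuousMap.ext fun y => ?_
  rw [jetC_apply hV hK (contDiffOn_slice hg hx), iteratedFDeriv_slice hU hV hg hx (hK y.2),
    sliceC_apply hK (contDiffOn_iteratedFDerivSnd (hU.prod hV) hg i).continuousOn hx]

theorem contDiffOn_comp_sliceC {K U V : Set E} [CompactSpace K] (hU : IsOpen U) (hV : IsOpen V)
    (hK : K ⊆ V) {g : E × E → ℂ} (hg : ContDiffOn ℝ (⊤ : ℕ∞) g (U ×ˢ V)) (i : ℕ)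
    (L : NormC K (E [×i]→L[ℝ] ℂ) →L[ℂ] ℂ) :
    ContDiffOn ℝ (⊤ : ℕ∞) (fun x => L (sliceC K (iteratedFDerivSnd i g) x)) U :=
  (L.restrictScalars ℝ).contDiff.comp_contDiffOn
    (contDiffOn_sliceC hU hV hK (contDiffOn_iteratedFDerivSnd (hU.prod hV) hg i))

theorem norm_iteratedFDeriv_comp_sliceC_le {K U V : Set E} [CompactSpace K] (hU : IsOpen U)
    (hV : IsOpen V) (hK : K ⊆ V) {g : E × E → ℂ} (hg : ContDiffOn ℝ (⊤ : ℕ∞) g (U ×ˢ V)) (i : ℕ)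
    {L : NormC K (E [×i]→L[ℝ] ℂ) →L[ℂ] ℂ} {C : ℝ} (hC : 0 ≤ C) (hL : ∀ φ, ‖L φ‖ ≤ C * ‖φ‖)
    {x : E} (hx : x ∈ U) (m : ℕ) {B : ℝ} (hB : 0 ≤ B)
    (h : ∀ y ∈ K, ‖iteratedFDeriv ℝ m (iteratedFDerivSnd i g) (x, y)‖ ≤ B) :
    ‖iteratedFDeriv ℝ m (fun x => L (sliceC K (iteratedFDerivSnd i g) x)) x‖ ≤ C * B := by
  have hs := contDiffOn_iteratedFDerivSnd (hU.prod hV) hg i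
  have h1 := ContinuousLinearMap.norm_iteratedFDeriv_comp_left
    (F := NormC K (E [×i]→L[ℝ] ℂ)) (G := ℂ) (L.restrictScalars ℝ) (n := m)
    ((contDiffOn_sliceC hU hV hK hs).contDiffAt (hU.mem_nhds hx)) (by exact_mod_cast le_top)
  refine h1.trans ?_
  have h2 : ‖L.restrictScalars ℝ‖ ≤ C := ContinuousLinearMap.opNorm_le_bound _ hC hL
  exact mul_le_mul h2 (norm_iteratedFDeriv_sliceC_le hU hV hK hs hx m hB h) (norm_nonneg _) hC

/-- A functional of order `j` applied to the slices of a smooth kernel is a smooth function. -/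
theorem contDiffOn_apply_slice {K U V : Set E} [CompactSpace K] (hU : IsOpen U) (hV : IsOpen V)
    (hK : K ⊆ V) {g : E × E → ℂ} (hg : ContDiffOn ℝ (⊤ : ℕ∞) g (U ×ˢ V)) {S : (E → ℂ) →ₗ[ℂ] ℂ}
    {j : ℕ} {L : (i : Fin (j + 1)) → NormC K (E [×(i : ℕ)]→L[ℝ] ℂ) →L[ℂ] ℂ}
    (hL : ∀ f : E → ℂ, ContDiffOn ℝ (⊤ : ℕ∞) f V → S f = ∑ i, L i (jetC K i f)) :
    ContDiffOn ℝ (⊤ : ℕ∞) (fun x => S (fun y => g (x, y))) U := by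
  refine (ContDiffOn.sum (s := Finset.univ) fun (i : Fin (j + 1)) _ =>
    contDiffOn_comp_sliceC hU hV hK hg i (L i)).congr
    fun x hx => ?_
  rw [hL _ (contDiffOn_slice hg hx)]
  simp only [jetC_slice hU hV hK hg hx]

theorem norm_iteratedFDeriv_apply_slice_le {K U V : Set E} [CompactSpace K] (hU : IsOpen U)
    (hV : IsOpen V) (hK : K ⊆ V) {g : E × E → ℂ} (hg : ContDiffOn ℝ (⊤ : ℕ∞) g (U ×ˢ V))
    {S : (E → ℂ) →ₗ[ℂ] ℂ} {j : ℕ} {L : (i : Fin (j + 1)) → NormC K (E [×(i : ℕ)]→L[ℝ] ℂ) →L[ℂ] ℂ}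
    (hL : ∀ f : E → ℂ, ContDiffOn ℝ (⊤ : ℕ∞) f V → S f = ∑ i, L i (jetC K i f))
    {C : ℝ} (hC : 0 ≤ C) (hLC : ∀ i φ, ‖L i φ‖ ≤ C * ‖φ‖) {x : E} (hx : x ∈ U) (m : ℕ)
    {B : Fin (j + 1) → ℝ} (hB : ∀ i, 0 ≤ B i)
    (h : ∀ i : Fin (j + 1), ∀ y ∈ K,
      ‖iteratedFDeriv ℝ m (iteratedFDerivSnd (i : ℕ) g) (x, y)‖ ≤ B i) :
    ‖iteratedFDeriv ℝ m (fun x => S (fun y => g (x, y))) x‖ ≤ C * ∑ i, B i := by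
  have he : (fun x => S (fun y => g (x, y))) =ᶠ[𝓝 x]
      fun x => ∑ i, L i (sliceC K (iteratedFDerivSnd (i : ℕ) g) x) := by
    filter_upwards [hU.mem_nhds hx] with z hz
    rw [hL _ (contDiffOn_slice hg hz)]
    simp only [jetC_slice hU hV hK hg hz]
  rw [(he.iteratedFDeriv ℝ m).eq_of_nhds, iteratedFDeriv_fun_sum_apply fun (i : Fin (j + 1)) _ =>
    ((contDiffOn_comp_sliceC hU hV hK hg i (L i)).contDiffAt (hU.mem_nhds hx)).of_le
      (by exact_mod_cast le_top), Finset.mul_sum]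
  exact norm_sum_le_of_le _ fun i _ =>
    norm_iteratedFDeriv_comp_sliceC_le hU hV hK hg i hC (hLC i) hx m (hB i) (h i)

end KernelSlices

section KernelIntegral

variable {E F : Type} [NormedAddCommGroup E] [NormedSpace ℝ E] [MeasurableSpace E] [BorelSpace E]
  [NormedAddCommGroup F] [NormedSpace ℝ F] [NormedSpace ℂ F]

theorem integrable_of_continuous_compactSpace {K : Set E} [CompactSpace K] (μ : Measure K)
    [IsFiniteMeasure μ] {φ : K → F} (hφ : Continuous φ) : Integrable φ μ :=
  hφ.integrable_of_hasCompactSupport (HasCompactSupport.of_compactSpace φ)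

/-- Integration of continuous functions on `K` against a continuous density. -/
def integralC {K : Set E} [CompactSpace K] (μ : Measure K) [IsFiniteMeasure μ] (w : C(K, ℂ)) :
    NormC K ℂ →L[ℝ] ℂ :=
  LinearMap.mkContinuous
    { toFun := fun h => ∫ x, w x * h x ∂μ
      map_add' := fun h₁ h₂ => by
        simp only [ContinuousMap.add_apply, mul_add]
        exact integral_add (integrable_of_continuous_compactSpace μ (by fun_prop))
          (integrable_of_continuous_compactSpace μ (by fun_prop))
      map_smul' := fun c h => by
        simp only [ContinuousMap.smul_apply, mul_smul_comm, RingHom.id_apply]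
        exact integral_smul c _ }
    (‖w‖ * μ.real univ) fun h => by
      have h1 : ∀ᵐ x ∂μ, ‖w x * h x‖ ≤ ‖w‖ * ‖h‖ := Filter.Eventually.of_forall fun x => by
        rw [norm_mul]
        exact mul_le_mul (w.norm_coe_le_norm x) (h.norm_coe_le_norm x) (norm_nonneg _)
          (norm_nonneg _)
      refine (norm_integral_le_of_norm_le_const h1).trans_eq (by ring)

theorem integralC_apply {K : Set E} [CompactSpace K] (μ : Measure K) [IsFiniteMeasure μ]
    (w : C(K, ℂ)) (h : NormC K ℂ) : integralC μ w h = ∫ x, w x * h x ∂μ := rfl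

theorem contDiffOn_swap {U V : Set E} {g : E × E → ℂ} (hg : ContDiffOn ℝ (⊤ : ℕ∞) g (U ×ˢ V)) :
    ContDiffOn ℝ (⊤ : ℕ∞) (fun p => g p.swap) (V ×ˢ U) :=
  hg.comp (contDiff_snd.prodMk contDiff_fst).contDiffOn fun _ hp => ⟨hp.2, hp.1⟩

theorem integral_slice_eq {K U V : Set E} [CompactSpace K] (μ : Measure K) [IsFiniteMeasure μ]
    (w : C(K, ℂ)) (hK : K ⊆ U) {g : E × E → ℂ} (hg : ContDiffOn ℝ (⊤ : ℕ∞) g (U ×ˢ V)) {y : E}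
    (hy : y ∈ V) :
    ∫ x : K, w x * g (x, y) ∂μ = integralC μ w (sliceC K (fun p => g p.swap) y) := by
  rw [integralC_apply]
  refine integral_congr_ae (Filter.Eventually.of_forall fun x => ?_)
  simp only [sliceC_apply hK (contDiffOn_swap hg).continuousOn hy, Prod.swap_prod_mk]

theorem contDiffOn_integral_slice {K U V : Set E} [CompactSpace K] (μ : Measure K)
    [IsFiniteMeasure μ] (w : C(K, ℂ)) (hU : IsOpen U) (hV : IsOpen V) (hK : K ⊆ U)
    {g : E × E → ℂ} (hg : ContDiffOn ℝ (⊤ : ℕ∞) g (U ×ˢ V)) :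
    ContDiffOn ℝ (⊤ : ℕ∞) (fun y => ∫ x : K, w x * g (x, y) ∂μ) V :=
  ((integralC μ w).contDiff.comp_contDiffOn
    (contDiffOn_sliceC hV hU hK (contDiffOn_swap hg))).congr
      fun _ hy => integral_slice_eq μ w hK hg hy

/-- Differentiation under the integral sign, to any order. -/
theorem iteratedFDeriv_integral_slice {K U V : Set E} [CompactSpace K] (μ : Measure K)
    [IsFiniteMeasure μ] (w : C(K, ℂ)) (hU : IsOpen U) (hV : IsOpen V) (hK : K ⊆ U)
    {g : E × E → ℂ} (hg : ContDiffOn ℝ (⊤ : ℕ∞) g (U ×ˢ V)) {y : E} (hy : y ∈ V) (i : ℕ)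
    (v : Fin i → E) :
    iteratedFDeriv ℝ i (fun y => ∫ x : K, w x * g (x, y) ∂μ) y v =
      ∫ x : K, w x * iteratedFDerivSnd i g (x, y) v ∂μ := by
  have hs : ContDiffAt ℝ (⊤ : ℕ∞) (sliceC K (fun p => g p.swap)) y :=
    (contDiffOn_sliceC hV hU hK (contDiffOn_swap hg)).contDiffAt (hV.mem_nhds hy)
  have he : (fun y => ∫ x : K, w x * g (x, y) ∂μ) =ᶠ[𝓝 y]
      integralC μ w ∘ sliceC K (fun p => g p.swap) := by
    filter_upwards [hV.mem_nhds hy] with z hz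
    exact integral_slice_eq μ w hK hg hz
  have h1 := ContinuousLinearMap.iteratedFDeriv_comp_left (F := NormC K ℂ) (G := ℂ)
    (integralC μ w) hs (i := i) (by exact_mod_cast le_top)
  rw [(he.iteratedFDeriv ℝ i).eq_of_nhds, h1,
    ContinuousLinearMap.compContinuousMultilinearMap_coe, Function.comp_apply, integralC_apply]
  refine integral_congr_ae (Filter.Eventually.of_forall fun x => ?_)
  have hx : (fun y => g (x, y)) =ᶠ[𝓝 y]
      ContinuousMap.evalCLM ℝ x ∘ sliceC K (fun p => g p.swap) := by
    filter_upwards [hV.mem_nhds hy] with z hz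
    exact (sliceC_apply hK (contDiffOn_swap hg).continuousOn hz x).symm
  have h2 := ContinuousLinearMap.iteratedFDeriv_comp_left (F := NormC K ℂ) (G := ℂ)
    (ContinuousMap.evalCLM ℝ x) hs (i := i) (by exact_mod_cast le_top)
  simp only [← iteratedFDeriv_slice hU hV hg (hK x.2) hy]
  rw [(hx.iteratedFDeriv ℝ i).eq_of_nhds, h2]
  rfl

theorem integral_normC_apply {K' K : Set E} [CompactSpace K'] [CompactSpace K] (μ : Measure K)
    [IsFiniteMeasure μ] [CompleteSpace F] {Φ : K → NormC K' F} (hΦ : Continuous Φ) (y : K') :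
    (∫ x, Φ x ∂μ) y = ∫ x, Φ x y ∂μ :=
  ((ContinuousMap.evalCLM ℝ y : NormC K' F →L[ℝ] F).integral_comp_comm
    (integrable_of_continuous_compactSpace μ hΦ)).symm

/-- The jet of an integral of slices is the integral of the jets. -/
theorem jetC_integral_slice {K' K U V : Set E} [CompactSpace K'] [CompactSpace K] (μ : Measure K)
    [IsFiniteMeasure μ] (w : C(K, ℂ)) (hU : IsOpen U) (hV : IsOpen V) (hK : K ⊆ U) (hK' : K' ⊆ V)
    {g : E × E → ℂ} (hg : ContDiffOn ℝ (⊤ : ℕ∞) g (U ×ˢ V)) (i : ℕ) :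
    jetC K' i (fun y => ∫ x : K, w x * g (x, y) ∂μ) =
      ∫ x : K, w x • sliceC K' (iteratedFDerivSnd i g) x ∂μ := by
  have hs := (contDiffOn_iteratedFDerivSnd (hU.prod hV) hg i).continuousOn
  have hc : Continuous fun x : K => w x • sliceC K' (iteratedFDerivSnd i g) x :=
    w.continuous.smul ((continuousOn_sliceC hK' hs).comp_continuous continuous_subtype_val
      fun x => hK x.2)
  refine ContinuousMap.ext fun y => ContinuousMultilinearMap.ext fun v => ?_
  rw [jetC_apply hV hK' (contDiffOn_integral_slice μ w hU hV hK hg),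
    iteratedFDeriv_integral_slice μ w hU hV hK hg (hK' y.2), integral_normC_apply μ hc]
  have hcy : Continuous fun x : K => (w x • sliceC K' (iteratedFDerivSnd i g) x) y :=
    (ContinuousMap.evalCLM ℝ y : NormC K' (E [×i]→L[ℝ] ℂ) →L[ℝ] _).continuous.comp hc
  have h3 := (ContinuousMultilinearMap.apply ℝ (fun _ : Fin i => E) ℂ v).integral_comp_comm
    (integrable_of_continuous_compactSpace μ hcy)
  refine Eq.trans ?_ h3
  refine integral_congr_ae (Filter.Eventually.of_forall fun x => ?_)
  simp [sliceC_apply hK' hs (hK x.2)]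

theorem apply_integral_slice {K' K U V : Set E} [CompactSpace K'] [CompactSpace K] (μ : Measure K)
    [IsFiniteMeasure μ] (w : C(K, ℂ)) (hU : IsOpen U) (hV : IsOpen V) (hK : K ⊆ U) (hK' : K' ⊆ V)
    {g : E × E → ℂ} (hg : ContDiffOn ℝ (⊤ : ℕ∞) g (U ×ˢ V)) {S : (E → ℂ) →ₗ[ℂ] ℂ} {j : ℕ}
    {L : (i : Fin (j + 1)) → NormC K' (E [×(i : ℕ)]→L[ℝ] ℂ) →L[ℂ] ℂ}
    (hL : ∀ f : E → ℂ, ContDiffOn ℝ (⊤ : ℕ∞) f V → S f = ∑ i, L i (jetC K' i f)) :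
    S (fun y => ∫ x : K, w x * g (x, y) ∂μ) = ∫ x : K, w x * S (fun y => g (x, y)) ∂μ := by
  have hs : ∀ i : Fin (j + 1),
      Continuous fun x : K => w x • sliceC K' (iteratedFDerivSnd (i : ℕ) g) x := fun i =>
    w.continuous.smul ((continuousOn_sliceC hK'
      (contDiffOn_iteratedFDerivSnd (hU.prod hV) hg i).continuousOn).comp_continuous
        continuous_subtype_val fun x => hK x.2)
  have h1 : ∀ i : Fin (j + 1), L i (jetC K' i (fun y => ∫ x : K, w x * g (x, y) ∂μ)) =
      ∫ x : K, L i (w x • sliceC K' (iteratedFDerivSnd (i : ℕ) g) x) ∂μ := fun i => by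
    rw [jetC_integral_slice μ w hU hV hK hK' hg]
    exact ((L i).integral_comp_comm (integrable_of_continuous_compactSpace μ (hs i))).symm
  rw [hL _ (contDiffOn_integral_slice μ w hU hV hK hg), Finset.sum_congr rfl fun i _ => h1 i,
    ← integral_finsetSum (f := fun (i : Fin (j + 1)) (x : K) =>
      L i (w x • sliceC K' (iteratedFDerivSnd (i : ℕ) g) x)) _ fun i _ =>
        integrable_of_continuous_compactSpace μ ((L i).continuous.comp (hs i))]
  refine integral_congr_ae (Filter.Eventually.of_forall fun x => ?_)
  simp only [hL _ (contDiffOn_slice hg (hK x.2)), jetC_slice hU hV hK' hg (hK x.2), map_smul,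
    smul_eq_mul, Finset.mul_sum]

end KernelIntegral

section CompactSupport

variable {n : ℕ}

theorem integral_eq_integral_comap {K : Set (Rn n)} (hK : MeasurableSet K) {φ : Rn n → ℂ}
    (hφ : ∀ x ∉ K, φ x = 0) :
    ∫ x, φ x = ∫ x : K, φ x ∂(volume.comap ((↑) : K → Rn n)) := by
  rw [integral_subtype_comap hK, setIntegral_eq_integral_of_forall_compl_eq_zero hφ]

theorem isFiniteMeasure_comap {K : Set (Rn n)} (hK : IsCompact K) :
    IsFiniteMeasure ((volume : Measure (Rn n)).comap ((↑) : K → Rn n)) := by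
  refine ⟨?_⟩
  rw [comap_subtype_coe_apply hK.measurableSet, image_univ, Subtype.range_coe]
  exact hK.measure_lt_top

/-- A compactly supported distribution has a finite jet representation. -/
theorem Colombeau.IsCptSuppDistributionOn.exists_representation {Ω : Set (Rn n)} (hΩ : IsOpen Ω)
    {S : (Rn n → ℂ) →ₗ[ℂ] ℂ} (hS : IsCptSuppDistributionOn Ω S) :
    ∃ K : Set (Rn n), IsCompact K ∧ K ⊆ Ω ∧ ∃ j : ℕ,
      ∃ L : (i : Fin (j + 1)) → NormC K (Rn n [×(i : ℕ)]→L[ℝ] ℂ) →L[ℂ] ℂ,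
        ∀ f : Rn n → ℂ, ContDiffOn ℝ (⊤ : ℕ∞) f Ω → S f = ∑ i, L i (jetC K i f) := by
  obtain ⟨K, hK, hKΩ, j, C, hC, h⟩ := hS
  have := isCompact_iff_compactSpace.1 hK
  obtain ⟨L, -, hL⟩ := exists_jet_representation hΩ hKΩ S j hC fun f hf B _ => h f hf B
  exact ⟨K, hK, hKΩ, j, L, hL⟩

/-- A compactly supported distribution can be exchanged with integration in a parameter. -/
theorem Colombeau.IsCptSuppDistributionOn.apply_integral {Ω : Set (Rn n)} (hΩ : IsOpen Ω)
    {S : (Rn n → ℂ) →ₗ[ℂ] ℂ} (hS : IsCptSuppDistributionOn Ω S) {g : Rn n × Rn n → ℂ}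
    (hg : ContDiffOn ℝ (⊤ : ℕ∞) g (Ω ×ˢ Ω)) {u : Rn n → ℂ} (hu : ContinuousOn u Ω)
    {K : Set (Rn n)} (hK : IsCompact K) (hKΩ : K ⊆ Ω) (huK : tsupport u ⊆ K) :
    S (fun y => ∫ x, g (x, y) * u x) = ∫ x, S (fun y => g (x, y)) * u x := by
  obtain ⟨K', hK', hK'Ω, j, L, hL⟩ := hS.exists_representation hΩ
  have := isCompact_iff_compactSpace.1 hK
  have := isCompact_iff_compactSpace.1 hK'
  have := isFiniteMeasure_comap hK
  have h0 : ∀ x ∉ K, u x = 0 := fun x hx => image_eq_zero_of_notMem_tsupport fun h => hx (huK h)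
  let w : C(K, ℂ) := ⟨fun x => u x, continuousOn_iff_continuous_domRestrict.1 (hu.mono hKΩ)⟩
  have h1 : ∀ G : Rn n → ℂ,
      ∫ x, G x * u x = ∫ x : K, w x * G x ∂(volume.comap ((↑) : K → Rn n)) := fun G => by
    rw [integral_eq_integral_comap hK.measurableSet fun x hx => by rw [h0 x hx, mul_zero]]
    exact integral_congr_ae (Filter.Eventually.of_forall fun x => mul_comm _ _)
  simp only [h1]
  exact apply_integral_slice _ w hΩ hΩ hKΩ hK'Ω hg hL

end CompactSupport

section Regularity

variable {n : ℕ}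

/-- Estimates holding for finitely many indices hold with common constants. -/
theorem exists_uniform_bound {j : ℕ} {P : ℕ → ℝ → ℝ → Prop}
    (h : ∀ i ≤ j, ∃ c > 0, ∃ η ∈ Ioc (0 : ℝ) 1, ∀ ε ∈ Ioc (0 : ℝ) η, P i c ε)
    (hP : ∀ i c c' ε, c ≤ c' → 0 < ε → P i c ε → P i c' ε) :
    ∃ c > 0, ∃ η ∈ Ioc (0 : ℝ) 1, ∀ ε ∈ Ioc (0 : ℝ) η, ∀ i ≤ j, P i c ε := by
  induction j with
  | zero =>
    obtain ⟨c, hc, η, hη, h0⟩ := h 0 le_rfl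
    refine ⟨c, hc, η, hη, fun ε hε i hi => ?_⟩
    obtain rfl : i = 0 := Nat.le_zero.1 hi
    exact h0 ε hε
  | succ j ih =>
    obtain ⟨c, hc, η, hη, h0⟩ := ih fun i hi => h i (hi.trans j.le_succ)
    obtain ⟨c', hc', η', hη', h1⟩ := h (j + 1) le_rfl
    refine ⟨max c c', lt_max_of_lt_left hc, min η η', ⟨lt_min hη.1 hη'.1,
      (min_le_left _ _).trans hη.2⟩, fun ε hε i hi => ?_⟩
    rcases Nat.le_succ_iff.1 hi with hi | rfl
    · exact hP _ _ _ _ (le_max_left _ _) hε.1 (h0 ε ⟨hε.1, hε.2.trans (min_le_left _ _)⟩ i hi)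
    · exact hP _ _ _ _ (le_max_right _ _) hε.1 (h1 ε ⟨hε.1, hε.2.trans (min_le_right _ _)⟩)

/-- A basic functional applied to the slices of a regular kernel is a regular generalized
function. -/
theorem Colombeau.IsBasicNetE.isGinfModerate_apply_slice {Ω : Set (Rn n)} (hΩ : IsOpen Ω)
    {k : ℝ → Rn n × Rn n → ℂ} (hk : IsGinfModerate (Ω ×ˢ Ω) k)
    {T : ℝ → (Rn n → ℂ) →ₗ[ℂ] ℂ} (hT : IsBasicNetE Ω T) :
    IsGinfModerate Ω (fun ε x => T ε (fun y => k ε (x, y))) := by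
  refine ⟨fun ε hε => ?_, fun A hA hAΩ => ?_⟩
  · obtain ⟨K, hK, hKΩ, j, L, hL⟩ := (hT.1 ε hε).exists_representation hΩ
    have := isCompact_iff_compactSpace.1 hK
    exact contDiffOn_apply_slice hΩ hΩ hKΩ (hk.1 ε hε) hL
  obtain ⟨K, hK, hKΩ, j, N, η₁, hη₁, hTb⟩ := hT.2
  have := isCompact_iff_compactSpace.1 hK
  obtain ⟨M, hM⟩ := hk.2 (A ×ˢ K) (hA.prod hK) (prod_mono hAΩ hKΩ)
  refine ⟨N + M, fun m => ?_⟩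
  obtain ⟨c, hc, η, hη, hcη⟩ := exists_uniform_bound (j := j)
    (P := fun i c ε => ∀ p ∈ A ×ˢ K, ‖iteratedFDeriv ℝ (m + i) (k ε) p‖ ≤ c * ε ^ (-(M : ℝ)))
    (fun i _ => hM (m + i)) fun i c c' ε hcc hε h p hp => (h p hp).trans (by gcongr)
  choose b hb hbk using fun i : Fin (j + 1) =>
    exists_norm_iteratedFDeriv_iteratedFDerivSnd_le (E := Rn n) (E' := Rn n) (F := ℂ) (i : ℕ)
  have hbs : 0 ≤ ∑ i, b i := Finset.sum_nonneg fun i _ => hb i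
  refine ⟨(∑ i, b i) * c + 1, by positivity, min η η₁, ⟨lt_min hη.1 hη₁.1,
    (min_le_left _ _).trans hη.2⟩, fun ε hε x hx => ?_⟩
  have hε0 := hε.1
  have hε1 := hε.2.trans (min_le_left _ _)
  have hεη₁ := hε.2.trans (min_le_right _ _)
  have hkε := hk.1 ε ⟨hε0, hε1.trans hη.2⟩
  have hεN : (0 : ℝ) ≤ ε ^ (-(N : ℝ)) := Real.rpow_nonneg hε0.le _
  have hεM : (0 : ℝ) ≤ ε ^ (-(M : ℝ)) := Real.rpow_nonneg hε0.le _
  obtain ⟨L, hLC, hL⟩ := exists_jet_representation hΩ hKΩ (T ε) j hεN (hTb ε ⟨hε0, hεη₁⟩)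
  have h1 := norm_iteratedFDeriv_apply_slice_le hΩ hΩ hKΩ hkε hL hεN hLC (hAΩ hx) m
    (B := fun i => b i * (c * ε ^ (-(M : ℝ)))) (fun i => mul_nonneg (hb i) (by positivity))
    fun i y hy => (hbk i _ (hΩ.prod hΩ) _ hkε (x, y) ⟨hAΩ hx, hKΩ hy⟩ m).trans
      (mul_le_mul_of_nonneg_left
        (hcη ε ⟨hε0, hε1⟩ i (Nat.lt_succ_iff.1 i.2) (x, y) ⟨hx, hy⟩) (hb i))
  refine h1.trans ?_
  have h2 : ε ^ (-((N + M : ℕ) : ℝ)) = ε ^ (-(N : ℝ)) * ε ^ (-(M : ℝ)) := by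
    rw [← Real.rpow_add hε0]
    push_cast
    ring_nf
  rw [h2, ← Finset.sum_mul]
  nlinarith [mul_nonneg hεN hεM]

end Regularity

/-- Let `k_R ∈ G^∞(Ω×Ω)` and let `R` be the integral operator with
kernel `k_R`, extended to the dual by `RT(u) := T(ᵗRu)` where
`ᵗRu(y) = ∫ k_R(x,y)u(x)dx`.  If `T ∈ L(G(Ω),ℂ̃)` is basic, then
`RT = (x ↦ T(k_R(x,·)))` belongs to `G^∞(Ω)`; i.e. operators with regular generalized
kernel are `G^∞`-regularizing on basic functionals of `L(G(Ω),ℂ̃)`. -/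
theorem statement12
    {n : ℕ} (Ω : Set (Rn n)) (hΩ : IsOpen Ω)
    (k : ℝ → (Rn n × Rn n) → ℂ) (hk : IsGinfModerate (Ω ×ˢ Ω) k)
    (T : ℝ → (Rn n → ℂ) →ₗ[ℂ] ℂ) (hT : IsBasicNetE Ω T) :
    -- `x ↦ T(k_R(x,·))` belongs to `G^∞(Ω)`
    IsGinfModerate Ω (fun ε x => T ε (fun y => k ε (x, y))) ∧
    -- and it is the value `RT` of the extended operator on `T`
    (∀ u : ℝ → Rn n → ℂ, IsModerate Ω u → HasCmpSupp Ω u →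
      CIsNegligible (fun ε =>
        T ε (fun y => ∫ x : Rn n, k ε (x, y) * u ε x) -
          ∫ x : Rn n, T ε (fun y => k ε (x, y)) * u ε x)) := by
  refine ⟨hT.isGinfModerate_apply_slice hΩ hk, fun u hu ⟨K, hK, hKΩ, huK⟩ q =>
    ⟨1, one_pos, 1, ⟨one_pos, le_rfl⟩, fun ε hε => ?_⟩⟩
  beta_reduce
  rw [(hT.1 ε hε).apply_integral hΩ (hk.1 ε hε) (hu.1 ε hε).continuousOn hK hKΩ (huK ε hε),
    sub_self, norm_zero, one_mul]
  exact Real.rpow_nonneg hε.1.le _
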